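/- Let (R,m) be a Noetherian local ring and M a finitely generated R-module with r = dim_R M ≥ 2. Assume there exists an integer t ≥ 0 such that e_1(Q,M) ≥ −t for every parameter ideal Q for M. Then dim_R U_M(0) ≤ r−2. -/

import Mathlib

open IsLocalRing

section Defs

variable (R : Type) [CommRing R]

/-- The length of a module, as the Krull dimension of its lattice of submodules. -/
noncomputable def mLength (M : Type) [AddCommGroup M] [Module R M] : WithBot ℕ∞ :=
  Order.krullDim (Submodule R M)

/-- The (Krull) dimension of a module. -/
noncomputable def mDim (M : Type) [AddCommGroup M] [Module R M] : WithBot ℕ∞ :=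
  ringKrullDim (R ⧸ Submodule.annihilator (⊤ : Submodule R M))

/-- `f` is eventually given by the Hilbert-type polynomial of degree `t` with
coefficients `s 0, …, s t` (written in the binomial basis with alternating signs). -/
def IsHilbPolyAt (f : ℕ → WithBot ℕ∞) (t : ℕ) (s : ℕ → ℤ) : Prop :=
  ∃ N : ℕ, ∀ n ≥ N, ∃ l : ℕ, f n = (l : ℕ∞) ∧
    (l : ℤ) = ∑ i ∈ Finset.range (t + 1), (-1 : ℤ) ^ i * s i * ((n + t - i).choose (t - i) : ℤ)

/-- `s 0, …, s t` are the Hilbert coefficients `e_i(I, M)`, i.e.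
`λ(M/I^{n+1}M) = ∑ (-1)^i e_i(I,M) C(n+t-i, t-i)` for `n ≫ 0`. -/
def HasHilbCoeffs (I : Ideal R) (M : Type) [AddCommGroup M] [Module R M]
    (t : ℕ) (s : ℕ → ℤ) : Prop :=
  IsHilbPolyAt (fun n => mLength R (M ⧸ (I ^ (n + 1) • (⊤ : Submodule R M)))) t s

/-- The unmixed component `U_M(0)` of `M`: the largest submodule of dimension `< dim M`. -/
noncomputable def unmixedComp (M : Type) [AddCommGroup M] [Module R M] : Submodule R M :=
  sSup {N : Submodule R M | mDim R ↥N < mDim R M}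

/-- `x` is a d-sequence on `M`. -/
def IsDSeq {r : ℕ} (x : Fin r → R) (M : Type) [AddCommGroup M] [Module R M] : Prop :=
  ∀ i j : Fin r, i ≤ j →
    Submodule.comap (LinearMap.lsmul R M (x i * x j))
        (Ideal.span (x '' {k | k < i}) • (⊤ : Submodule R M))
      = Submodule.comap (LinearMap.lsmul R M (x j))
        (Ideal.span (x '' {k | k < i}) • (⊤ : Submodule R M))

/-- `x` is a standard (d⁺-) system: all power sequences in any order are d-sequences. -/
def IsStandardSeq {r : ℕ} (x : Fin r → R) (M : Type) [AddCommGroup M] [Module R M] : Prop :=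
  ∀ n : Fin r → ℕ, (∀ k, 1 ≤ n k) → ∀ σ : Equiv.Perm (Fin r),
    IsDSeq R (fun k => x (σ k) ^ n (σ k)) M

/-- The integral closure of an ideal, as a set. -/
def intClos (Q : Ideal R) : Set R :=
  {x : R | ∃ n : ℕ, 0 < n ∧ ∃ a : ℕ → R, (∀ i, 1 ≤ i → i ≤ n → a i ∈ Q ^ i) ∧
    x ^ n + ∑ i ∈ Finset.Icc 1 n, a i * x ^ (n - i) = 0}

variable [IsLocalRing R]

/-- `h ∈ I` is superficial for `M` with respect to `I`. -/
def IsSuperficial (I : Ideal R) (M : Type) [AddCommGroup M] [Module R M] (h : R) : Prop :=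
  h ∈ I ∧ ∃ c N : ℕ, ∀ n ≥ N,
    Submodule.comap (LinearMap.lsmul R M h) (I ^ (n + 1) • (⊤ : Submodule R M))
        ⊓ (I ^ c • (⊤ : Submodule R M))
      = I ^ n • (⊤ : Submodule R M)

/-- `Q` is a parameter ideal for `M` (`r` the dimension of `M`):
generated by `r` elements of the maximal ideal with `M/QM` of finite length. -/
def IsParamIdeal (Q : Ideal R) (M : Type) [AddCommGroup M] [Module R M] (r : ℕ) : Prop :=
  Q ≤ maximalIdeal R ∧ (∃ x : Fin r → R, Q = Ideal.span (Set.range x)) ∧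
    IsFiniteLength R (M ⧸ Q • (⊤ : Submodule R M))

/-- Local cohomology `H^i_𝔪(M)` with support in the maximal ideal. -/
noncomputable def LC (i : ℕ) (M : Type) [AddCommGroup M] [Module R M] : ModuleCat R :=
  (localCohomology (maximalIdeal R) i).obj (ModuleCat.of R M)

/-- `M` is Cohen–Macaulay: there is a regular sequence on `M` in the maximal ideal
whose length equals `dim M`. -/
def IsCM (M : Type) [AddCommGroup M] [Module R M] : Prop :=
  ∃ rs : List R, (∀ x ∈ rs, x ∈ maximalIdeal R) ∧ RingTheory.Sequence.IsRegular M rs ∧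
    (rs.length : WithBot ℕ∞) = mDim R M

/-- `M` is unmixed: `dim R̂/p = dim M` for every associated prime `p` of the completion `M̂`. -/
def IsUnmixed (M : Type) [AddCommGroup M] [Module R M] : Prop :=
  ∀ p ∈ associatedPrimes (AdicCompletion (maximalIdeal R) R)
      (AdicCompletion (maximalIdeal R) M),
    ringKrullDim ((AdicCompletion (maximalIdeal R) R) ⧸ p) = mDim R M

/-- `M` is generalized Cohen–Macaulay: `H^i_𝔪(M)` has finite length for `i < r = dim M`. -/
def IsGenCM (M : Type) [AddCommGroup M] [Module R M] (r : ℕ) : Prop :=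
  ∀ i < r, IsFiniteLength R ↥(LC R i M)

/-- The set `Λ(M)` of first Hilbert coefficients of parameter ideals for `M`. -/
def Lambda (M : Type) [AddCommGroup M] [Module R M] (r : ℕ) : Set ℤ :=
  {a : ℤ | ∃ (Q : Ideal R) (e : ℕ → ℤ),
    IsParamIdeal R Q M r ∧ HasHilbCoeffs R Q M r e ∧ e 1 = a}

/-- A standard parameter ideal: one generated by a standard system of parameters. -/
def IsStandardParamIdeal (Q : Ideal R) (M : Type) [AddCommGroup M] [Module R M]
    (r : ℕ) : Prop :=
  IsParamIdeal R Q M r ∧ ∃ x : Fin r → R, Q = Ideal.span (Set.range x) ∧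
    IsStandardSeq R x M

/-- `M` is Buchsbaum: every parameter ideal for `M` is standard. -/
def IsBuchsbaum (M : Type) [AddCommGroup M] [Module R M] (r : ℕ) : Prop :=
  ∀ Q : Ideal R, IsParamIdeal R Q M r → IsStandardParamIdeal R Q M r

/-- `M` is a Vasconcelos module. -/
def IsVasconcelos (M : Type) [AddCommGroup M] [Module R M] : Prop :=
  mDim R M ≤ 0 ∨ (0 < mDim R M ∧ ∃ (r : ℕ) (Q : Ideal R) (e : ℕ → ℤ),
    mDim R M = (r : ℕ∞) ∧ IsParamIdeal R Q M r ∧ HasHilbCoeffs R Q M r e ∧ e 1 = 0)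

/-- A Gorenstein local ring: Noetherian, Cohen–Macaulay, with an irreducible parameter ideal. -/
def IsGorensteinLocalRing : Prop :=
  IsNoetherianRing R ∧ IsCM R R ∧ ∃ (r : ℕ) (Q : Ideal R),
    mDim R R = (r : ℕ∞) ∧ IsParamIdeal R Q R r ∧
    ∀ I J : Ideal R, Q = I ⊓ J → Q = I ∨ Q = J

/-- `E` is an injective envelope of the residue field `R/𝔪`. -/
def IsInjEnvResidue (E : Type) [AddCommGroup E] [Module R E] : Prop :=
  Module.Injective R E ∧ ∃ ι : (R ⧸ maximalIdeal R) →ₗ[R] E, Function.Injective ι ∧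
    ∀ N : Submodule R E, N ⊓ LinearMap.range ι = ⊥ → N = ⊥

end Defs

/-- A (not necessarily local) Cohen–Macaulay ring: Noetherian,
with all localizations at primes Cohen–Macaulay. -/
def IsCMRing (S : Type) [CommRing S] : Prop :=
  IsNoetherianRing S ∧ ∀ (p : Ideal S) [p.IsPrime],
    IsCM (Localization.AtPrime p) (Localization.AtPrime p)

/-- A (not necessarily local) Gorenstein ring. -/
def IsGorensteinRing (S : Type) [CommRing S] : Prop :=
  IsNoetherianRing S ∧ ∀ (p : Ideal S) [p.IsPrime],
    IsGorensteinLocalRing (Localization.AtPrime p)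

/-- `HDegRel R I E M v` : `v` is the homological degree `hdeg_I(M)` computed
with Matlis duals taken relative to `E`. -/
inductive HDegRel (R : Type) [CommRing R] [IsLocalRing R] (I : Ideal R)
    (E : Type) [AddCommGroup E] [Module R E] : ModuleCat R → ℕ → Prop where
  | base : ∀ (M : ModuleCat R) (l : ℕ), mDim R M ≤ 0 → mLength R M = (l : ℕ∞) →
      HDegRel R I E M l
  | step : ∀ (M : ModuleCat R) (r : ℕ), mDim R M = (r : ℕ∞) → 0 < r →
      ∀ (e : ℕ → ℤ) (e0 : ℕ), HasHilbCoeffs R I M r e → e 0 = (e0 : ℤ) →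
      ∀ v : ℕ → ℕ,
        (∀ j < r, HDegRel R I E (ModuleCat.of R ((LC R j M) →ₗ[R] E)) (v j)) →
      HDegRel R I E M (e0 + ∑ j ∈ Finset.range r, (r - 1).choose j * v j)

open Filter Topology

/-- `IsPolyType d c f`: for large arguments `f` is an integer-valued polynomial function of degree
at most `d` whose leading coefficient, in the binomial basis, is `c`. -/
def IsPolyType : ℕ → ℤ → (ℕ → ℤ) → Prop
  | 0, c, f => ∀ᶠ n in atTop, f n = c
  | d + 1, c, f => ∃ g, IsPolyType d c g ∧ ∀ᶠ n in atTop, f (n + 1) - f n = g (n + 1)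

namespace IsPolyType

theorem add {d : ℕ} {c c' : ℤ} {f f' : ℕ → ℤ} (h : IsPolyType d c f) (h' : IsPolyType d c' f') :
    IsPolyType d (c + c') (fun n => f n + f' n) := by
  induction d generalizing f f' with
  | zero =>
    simp only [IsPolyType] at h h' ⊢
    filter_upwards [h, h'] with n h1 h2
    rw [h1, h2]
  | succ d ih =>
    obtain ⟨g, hg, hfg⟩ := h
    obtain ⟨g', hg', hfg'⟩ := h'
    refine ⟨_, ih hg hg', ?_⟩
    filter_upwards [hfg, hfg'] with n h1 h2
    rw [← h1, ← h2]
    ring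

theorem neg {d : ℕ} {c : ℤ} {f : ℕ → ℤ} (h : IsPolyType d c f) :
    IsPolyType d (-c) (fun n => -f n) := by
  induction d generalizing f with
  | zero =>
    simp only [IsPolyType] at h ⊢
    filter_upwards [h] with n h1
    rw [h1]
  | succ d ih =>
    obtain ⟨g, hg, hfg⟩ := h
    refine ⟨_, ih hg, ?_⟩
    filter_upwards [hfg] with n h1
    rw [← h1]
    ring

theorem lift {d : ℕ} {c : ℤ} {f : ℕ → ℤ} (h : IsPolyType d c f) : IsPolyType (d + 1) 0 f := by
  induction d generalizing f with
  | zero =>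
    simp only [IsPolyType] at h ⊢
    refine ⟨fun _ => 0, by simp, ?_⟩
    filter_upwards [h, (tendsto_add_atTop_nat 1).eventually h] with n h1 h2
    rw [h1, h2, sub_self]
  | succ d ih =>
    obtain ⟨g, hg, hfg⟩ := h
    exact ⟨g, ih hg, hfg⟩

theorem shift {d : ℕ} {c : ℤ} {f : ℕ → ℤ} (h : IsPolyType d c f) :
    IsPolyType d c (fun n => f (n - 1)) := by
  induction d generalizing f with
  | zero => exact (tendsto_sub_atTop_nat 1).eventually h
  | succ d ih =>
    obtain ⟨g, hg, hfg⟩ := h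
    refine ⟨_, ih hg, ?_⟩
    filter_upwards [(tendsto_sub_atTop_nat 1).eventually hfg, eventually_ge_atTop 1] with n h1 h2
    rw [Nat.sub_add_cancel h2] at h1
    exact h1

theorem congr {d : ℕ} {c : ℤ} {f f' : ℕ → ℤ} (h : IsPolyType d c f)
    (hff : ∀ᶠ n in atTop, f n = f' n) : IsPolyType d c f' := by
  cases d with
  | zero =>
    filter_upwards [h, hff] with n h1 h2
    rw [← h2, h1]
  | succ d =>
    obtain ⟨g, hg, hfg⟩ := h
    refine ⟨g, hg, ?_⟩
    filter_upwards [hfg, hff, (tendsto_add_atTop_nat 1).eventually hff] with n h1 h2 h3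
    rw [← h1, h2, h3]

theorem convolution {d : ℕ} (F : ℕ → ℕ → ℤ) (c : ℕ → ℤ) (hF : ∀ a, IsPolyType d (c a) (F a))
    (a₀ : ℕ) (hstab : ∀ a ≥ a₀, F a = F a₀) :
    IsPolyType (d + 1) (c a₀) (fun n => ∑ a ∈ Finset.range (n + 1), F a (n - a)) := by
  induction a₀ generalizing F c with
  | zero =>
    refine ⟨F 0, hF 0, Eventually.of_forall fun n => ?_⟩
    have h0 : ∀ a, F a = F 0 := fun a => hstab a (Nat.zero_le _)
    simp only [Finset.sum_range_succ' _ (n + 1)]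
    simp [h0]
  | succ a₀ ih =>
    have := ih (fun a => F (a + 1)) (fun a => c (a + 1)) (fun a => hF (a + 1))
      fun a ha => hstab (a + 1) (by omega)
    have h2 := (hF 0).lift.add this.shift
    rw [zero_add] at h2
    refine h2.congr ?_
    filter_upwards [eventually_ge_atTop 1] with n hn
    obtain ⟨m, rfl⟩ := Nat.exists_eq_add_of_le' hn
    rw [Finset.sum_range_succ' _ (m + 1)]
    simp [add_comm]

theorem exists_coeffs {d : ℕ} {c : ℤ} {f : ℕ → ℤ} (h : IsPolyType d c f) :
    ∃ s : ℕ → ℤ, s 0 = c ∧ ∀ᶠ n in atTop, f n =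
      ∑ i ∈ Finset.range (d + 1), (-1 : ℤ) ^ i * s i * ((n + d - i).choose (d - i) : ℤ) := by
  induction d generalizing f with
  | zero =>
    refine ⟨fun _ => c, rfl, ?_⟩
    simp only [IsPolyType] at h
    filter_upwards [h] with n h1
    simp [h1]
  | succ d ih =>
    obtain ⟨g, hg, hfg⟩ := h
    obtain ⟨s, hs0, hs⟩ := ih hg
    obtain ⟨N, hN⟩ := eventually_atTop.1 (hfg.and ((tendsto_add_atTop_nat 1).eventually hs))
    let P : ℕ → ℤ := fun n => ∑ i ∈ Finset.range (d + 1),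
      (-1 : ℤ) ^ i * s i * ((n + (d + 1) - i).choose (d + 1 - i) : ℤ)
    have hP : ∀ n, P (n + 1) - P n = ∑ i ∈ Finset.range (d + 1),
        (-1 : ℤ) ^ i * s i * ((n + 1 + d - i).choose (d - i) : ℤ) := by
      intro n
      rw [← Finset.sum_sub_distrib]
      refine Finset.sum_congr rfl fun i hi => ?_
      have hi' : i ≤ d := by simpa [Nat.lt_succ_iff] using hi
      rw [← mul_sub]
      congr 1
      have e1 : n + 1 + (d + 1) - i = (n + 1 + d - i) + 1 := by omega
      have e2 : n + (d + 1) - i = n + 1 + d - i := by omega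
      have e3 : d + 1 - i = (d - i) + 1 := by omega
      rw [e1, e2, e3, Nat.choose_succ_succ]
      push_cast
      ring
    have hconst : ∀ n ≥ N, f n - P n = f N - P N := by
      intro n hn
      induction n, hn using Nat.le_induction with
      | base => rfl
      | succ n hn ih2 =>
        obtain ⟨h1, h2⟩ := hN n hn
        have := hP n
        linarith
    refine ⟨Function.update s (d + 1) ((-1) ^ (d + 1) * (f N - P N)), by simp [hs0], ?_⟩
    filter_upwards [eventually_ge_atTop N] with n hn
    rw [Finset.sum_range_succ]
    have : ∑ i ∈ Finset.range (d + 1), (-1 : ℤ) ^ i *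
        Function.update s (d + 1) ((-1) ^ (d + 1) * (f N - P N)) i *
        ((n + (d + 1) - i).choose (d + 1 - i) : ℤ) = P n := by
      refine Finset.sum_congr rfl fun i hi => ?_
      rw [Function.update_of_ne]
      have := Finset.mem_range.1 hi
      omega
    rw [this, ← hconst n hn]
    simp [← mul_assoc, ← mul_pow]

end IsPolyType

theorem tendsto_choose_add_div_pow (k : ℕ) :
    Tendsto (fun n : ℕ => ((n + k).choose k : ℝ) / ((n : ℝ) + 1) ^ k) atTop (𝓝 (1 / k.factorial)) := by
  have h1 : Tendsto (fun n : ℕ => (n.choose k : ℝ) / (n : ℝ) ^ k) atTop (𝓝 (1 / k.factorial)) := by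
    have h := (isEquivalent_choose k)
    have h2 := h.div (Asymptotics.IsEquivalent.refl (u := fun n : ℕ => (n : ℝ) ^ k) (l := atTop))
    refine (h2.symm.tendsto_nhds ?_)
    refine tendsto_const_nhds.congr' ?_
    filter_upwards [eventually_gt_atTop 0] with n hn
    have : (n : ℝ) ^ k ≠ 0 := by positivity
    simp only [Pi.div_apply]
    field_simp
  have h2 := h1.comp (tendsto_add_atTop_nat k)
  have h3 : Tendsto (fun n : ℕ => (((n : ℝ) + k) / ((n : ℝ) + 1)) ^ k) atTop (𝓝 (1 ^ k)) := by
    refine Tendsto.pow ?_ k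
    have := tendsto_add_mul_div_add_mul_atTop_nhds (k : ℝ) 1 (1 : ℝ) (one_ne_zero)
    simpa [add_comm] using this
  have h4 := h2.mul h3
  rw [one_pow, mul_one] at h4
  refine h4.congr' ?_
  filter_upwards [eventually_gt_atTop 0] with n hn
  have : ((n : ℝ) + k) ≠ 0 := by positivity
  simp only [Function.comp]
  push_cast
  rw [div_pow]
  field_simp

theorem tendsto_binomial_sum_div_pow (d : ℕ) (s : ℕ → ℤ) :
    Tendsto (fun n : ℕ => ((∑ i ∈ Finset.range (d + 1),
      (-1 : ℤ) ^ i * s i * ((n + d - i).choose (d - i) : ℤ) : ℤ) : ℝ) / ((n : ℝ) + 1) ^ d) atTop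
      (𝓝 ((s 0 : ℝ) / d.factorial)) := by
  have key : ∀ i ∈ Finset.range (d + 1), Tendsto (fun n : ℕ =>
      (((-1 : ℤ) ^ i * s i * ((n + d - i).choose (d - i) : ℤ) : ℤ) : ℝ) / ((n : ℝ) + 1) ^ d) atTop
      (𝓝 (if i = 0 then (s 0 : ℝ) / d.factorial else 0)) := by
    intro i hi
    have hi' : i ≤ d := by simpa [Nat.lt_succ_iff] using hi
    have h1 := tendsto_choose_add_div_pow (d - i)
    have h2 : Tendsto (fun n : ℕ => (1 / ((n : ℝ) + 1)) ^ i) atTop (𝓝 (0 ^ i)) :=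
      tendsto_one_div_add_atTop_nhds_zero_nat.pow i
    have h3 := ((h1.mul h2).const_mul (((-1 : ℤ) ^ i * s i : ℤ) : ℝ))
    have e : (((-1 : ℤ) ^ i * s i : ℤ) : ℝ) * (1 / (d - i).factorial * 0 ^ i) =
        if i = 0 then (s 0 : ℝ) / d.factorial else 0 := by
      split_ifs with h0
      · subst h0; simp [div_eq_mul_inv]
      · simp [h0]
    rw [e] at h3
    refine h3.congr fun n => ?_
    have e2 : n + d - i = n + (d - i) := by omega
    have e3 : ((n : ℝ) + 1) ^ d = ((n : ℝ) + 1) ^ (d - i) * ((n : ℝ) + 1) ^ i := by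
      rw [← pow_add, Nat.sub_add_cancel hi']
    have : (n : ℝ) + 1 ≠ 0 := by positivity
    rw [e2, e3, one_div, inv_pow]
    push_cast
    field_simp
  have := tendsto_finsetSum _ key
  simp only [Finset.sum_ite_eq', Finset.mem_range, Nat.succ_pos, if_true] at this
  refine this.congr fun n => ?_
  push_cast
  rw [Finset.sum_div]

theorem IsPolyType.tendsto_div_pow {d : ℕ} {c : ℤ} {f : ℕ → ℤ} (h : IsPolyType d c f) :
    Tendsto (fun n : ℕ => (f n : ℝ) / ((n : ℝ) + 1) ^ d) atTop (𝓝 ((c : ℝ) / d.factorial)) := by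
  obtain ⟨s, rfl, hs⟩ := h.exists_coeffs
  refine (tendsto_binomial_sum_div_pow d s).congr' ?_
  filter_upwards [hs] with n hn
  rw [hn]

/-- The sum of `h α` over all `α ∈ ℕ^r` with `|α| ≤ n`. -/
def simplexSum : ∀ r : ℕ, ((Fin r → ℕ) → ℕ) → ℕ → ℕ
  | 0, h, _ => h ![]
  | r + 1, h, n => ∑ a ∈ Finset.range (n + 1), simplexSum r (fun β => h (Fin.cons a β)) (n - a)

theorem simplexSum_mono (r : ℕ) {h h' : (Fin r → ℕ) → ℕ} (hh : ∀ α, h α ≤ h' α) (n : ℕ) :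
    simplexSum r h n ≤ simplexSum r h' n := by
  induction r generalizing n with
  | zero => exact hh _
  | succ r ih => exact Finset.sum_le_sum fun a _ => ih (fun β => hh _) _

theorem simplexSum_const (r c n : ℕ) : simplexSum r (fun _ => c) n = c * (n + r).choose r := by
  induction r generalizing n with
  | zero => simp [simplexSum]
  | succ r ih =>
    simp only [simplexSum, ih]
    rw [← Finset.mul_sum]
    congr 1
    rw [← Finset.sum_range_reflect]
    have := Nat.sum_range_add_choose n r
    rw [← add_assoc, ← this]
    refine Finset.sum_congr rfl fun i hi => ?_
    have := Finset.mem_range.1 hi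
    congr 2
    omega

theorem exists_fin_cons_stable {r : ℕ} (h : (Fin (r + 1) → ℕ) → ℕ) (hh : Antitone h) :
    ∃ a₀ : ℕ, ∀ a ≥ a₀, ∀ β, h (Fin.cons a β) = h (Fin.cons a₀ β) := by
  have hfin : ∀ j : ℕ, ∃ a₀ : ℕ, ∀ α, h α ≤ j → ∃ γ ≤ α, h γ ≤ j ∧ γ 0 ≤ a₀ := by
    intro j
    have hf : {α | Minimal (fun α => h α ≤ j) α}.Finite :=
      (setOfPred_minimal_antichain _).finite_of_partiallyWellOrderedOn
        (Set.isPWO_of_wellQuasiOrderedLE _)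
    obtain ⟨a₀, ha₀⟩ := (hf.image fun α => α 0).bddAbove
    refine ⟨a₀, fun α hα => ?_⟩
    obtain ⟨γ, hγ, hm⟩ := exists_minimal_le_of_wellFoundedLT (fun α => h α ≤ j) α hα
    exact ⟨γ, hγ, hm.prop, ha₀ ⟨γ, hm, rfl⟩⟩
  choose A hA using hfin
  obtain ⟨a₀, ha₀⟩ := ((Finset.range (h 0 + 1)).image A).bddAbove
  refine ⟨a₀, fun a ha β => le_antisymm ?_ ?_⟩
  · exact hh (Fin.cons_le_cons.2 ⟨ha, le_rfl⟩)
  · have hj : h (Fin.cons a β) ≤ h 0 := hh (fun i => Nat.zero_le _)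
    obtain ⟨γ, hγ, h1, h2⟩ := hA _ (Fin.cons a β) le_rfl
    refine (hh ?_).trans h1
    intro i
    refine Fin.cases ?_ (fun i => ?_) i
    · exact h2.trans (ha₀ (by
        simp only [Finset.coe_image, Finset.coe_range, Set.mem_image, Set.mem_Iio]
        exact ⟨_, Nat.lt_succ_of_le hj, rfl⟩))
    · simpa using hγ i.succ

theorem isPolyType_simplexSum (r : ℕ) (h : (Fin r → ℕ) → ℕ) (hh : Antitone h) :
    ∃ c : ℕ, IsPolyType r c (fun n => (simplexSum r h n : ℤ)) ∧ ∀ α, c ≤ h α := by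
  induction r with
  | zero =>
    refine ⟨h ![], Eventually.of_forall fun n => rfl, fun α => ?_⟩
    rw [Subsingleton.elim α ![]]
  | succ r ih =>
    obtain ⟨a₀, ha₀⟩ := exists_fin_cons_stable h hh
    have hanti : ∀ a : ℕ, Antitone fun β => h (Fin.cons a β) := fun a β β' hβ =>
      hh (Fin.cons_le_cons.2 ⟨le_rfl, hβ⟩)
    choose c hc hcle using fun a => ih (fun β => h (Fin.cons a β)) (hanti a)
    refine ⟨c a₀, ?_, fun α => ?_⟩
    · have := IsPolyType.convolution (fun a n => (simplexSum r (fun β => h (Fin.cons a β)) n : ℤ))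
        (fun a => c a) hc a₀ fun a ha => by
          funext n
          simp only [ha₀ a ha]
      simpa only [simplexSum, Nat.cast_sum] using this
    · rw [← Fin.cons_self_tail α]
      rcases le_total (α 0) a₀ with h1 | h1
      · exact (hcle a₀ _).trans (hh (Fin.cons_le_cons.2 ⟨h1, le_rfl⟩))
      · rw [ha₀ _ h1]
        exact hcle a₀ _

theorem simplexSum_eq_sum_antidiagonalTuple (r : ℕ) (h : (Fin r → ℕ) → ℕ) (n : ℕ) :
    simplexSum r h n =
      ∑ m ∈ Finset.range (n + 1), ∑ α ∈ Finset.Nat.antidiagonalTuple r m, h α := by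
  induction r generalizing n with
  | zero =>
    rw [Finset.sum_range_succ']
    simp [simplexSum]
  | succ r ih =>
    simp only [simplexSum, ih]
    rw [Finset.sum_sigma', Finset.sum_sigma', Finset.sum_sigma']
    refine Finset.sum_bij' (fun x _ => ⟨x.1.1 + x.1.2, Fin.cons x.1.1 x.2⟩)
      (fun y _ => ⟨⟨y.2 0, y.1 - y.2 0⟩, Fin.tail y.2⟩) ?_ ?_ ?_ ?_ ?_
    · rintro ⟨⟨a, m⟩, β⟩ hx
      simp only [Finset.mem_sigma, Finset.mem_range, Finset.Nat.mem_antidiagonalTuple] at hx ⊢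
      rw [Fin.sum_cons]
      omega
    · rintro ⟨m, α⟩ hy
      simp only [Finset.mem_sigma, Finset.mem_range, Finset.Nat.mem_antidiagonalTuple] at hy ⊢
      rw [Fin.sum_univ_succ] at hy
      simp only [Fin.tail]
      omega
    · rintro ⟨⟨a, m⟩, β⟩ hx
      simp
    · rintro ⟨m, α⟩ hy
      simp only [Finset.mem_sigma, Finset.mem_range, Finset.Nat.mem_antidiagonalTuple] at hy ⊢
      rw [Fin.sum_univ_succ] at hy
      have : α 0 + (m - α 0) = m := by omega
      simp [this]
    · rintro ⟨⟨a, m⟩, β⟩ hx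
      rfl
theorem length_quotient_eq_add_comap {R M P : Type*} [CommRing R] [AddCommGroup M] [Module R M]
    [AddCommGroup P] [Module R P] (φ : P →ₗ[R] M) (W : Submodule R M) :
    Module.length R (M ⧸ W) =
      Module.length R (M ⧸ (W ⊔ LinearMap.range φ)) + Module.length R (P ⧸ W.comap φ) := by
  rw [add_comm]
  refine Module.length_eq_add_of_exact (Submodule.mapQ (W.comap φ) W φ le_rfl)
    (Submodule.mapQ W (W ⊔ LinearMap.range φ) LinearMap.id le_sup_left) ?_ ?_ ?_
  · rw [← LinearMap.ker_eq_bot, Submodule.ker_mapQ, Submodule.mkQ_map_self]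
  · intro y
    obtain ⟨y, rfl⟩ := Submodule.Quotient.mk_surjective _ y
    exact ⟨Submodule.Quotient.mk y, rfl⟩
  · intro y
    obtain ⟨y, rfl⟩ := Submodule.Quotient.mk_surjective _ y
    rw [Submodule.mapQ_apply, LinearMap.id_apply, Submodule.Quotient.mk_eq_zero,
      Submodule.mem_sup]
    constructor
    · rintro ⟨w, hw, _, ⟨z, rfl⟩, rfl⟩
      refine ⟨Submodule.Quotient.mk z, ?_⟩
      rw [Submodule.mapQ_apply, eq_comm, Submodule.Quotient.eq]
      simpa using hw
    · rintro ⟨z, hz⟩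
      obtain ⟨z, rfl⟩ := Submodule.Quotient.mk_surjective _ z
      rw [Submodule.mapQ_apply, eq_comm, Submodule.Quotient.eq] at hz
      exact ⟨_, hz, _, ⟨z, rfl⟩, by simp⟩

theorem length_quotient_anti {R M : Type*} [CommRing R] [AddCommGroup M] [Module R M]
    {W W' : Submodule R M} (h : W ≤ W') : Module.length R (M ⧸ W') ≤ Module.length R (M ⧸ W) :=
  Module.length_le_of_surjective (Submodule.factor h) (Submodule.factor_surjective h)

theorem length_quotient_eq_add_sum {R M ι : Type*} [CommRing R] [AddCommGroup M] [Module R M]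
    [LinearOrder ι] (f : ι → M →ₗ[R] M) (W : Submodule R M) (s : Finset ι) :
    Module.length R (M ⧸ W) =
      Module.length R (M ⧸ (W ⊔ ⨆ β ∈ s, LinearMap.range (f β))) +
      ∑ α ∈ s, Module.length R
        (M ⧸ (W ⊔ ⨆ β ∈ s, ⨆ (_ : β < α), LinearMap.range (f β)).comap (f α)) := by
  induction s using Finset.induction_on_max with
  | empty =>
    have e : (⨆ β ∈ (∅ : Finset ι), LinearMap.range (f β)) = ⊥ := by simp
    rw [e, sup_bot_eq, Finset.sum_empty, add_zero]
  | insert a s hlt ih =>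
    have ha : a ∉ s := fun h => lt_irrefl _ (hlt a h)
    rw [ih, length_quotient_eq_add_comap (f a), Finset.sum_insert ha, add_assoc]
    have e1 : W ⊔ (⨆ β ∈ s, LinearMap.range (f β)) ⊔ LinearMap.range (f a) =
        W ⊔ ⨆ β ∈ insert a s, LinearMap.range (f β) := by
      rw [Finset.iSup_insert, sup_assoc, sup_comm (LinearMap.range (f a))]
    have e2 : (⨆ β ∈ insert a s, ⨆ (_ : β < a), LinearMap.range (f β)) =
        ⨆ β ∈ s, LinearMap.range (f β) := by
      rw [Finset.iSup_insert]
      simp only [lt_irrefl, iSup_false, bot_sup_eq]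
      exact iSup_congr fun β => iSup_congr fun hβ => by simp [hlt β hβ]
    have e3 : ∀ α ∈ s, (⨆ β ∈ insert a s, ⨆ (_ : β < α), LinearMap.range (f β)) =
        ⨆ β ∈ s, ⨆ (_ : β < α), LinearMap.range (f β) := by
      intro α hα
      rw [Finset.iSup_insert]
      simp [(hlt α hα).not_gt]
    rw [e1, e2]
    congr 2
    exact Finset.sum_congr rfl fun α hα => by rw [e3 α hα]

section Monomial

variable {R M : Type*} [CommRing R] [AddCommGroup M] [Module R M] {r : ℕ}

/-- The submodule of `M` spanned by `Q ^ (|α| + 1) M`, by `Y`, and by all `x ^ β M` with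
`|β| = |α|` and `β` lexicographically smaller than `α`. -/
noncomputable def lexStep (x : Fin r → R) (Y : Submodule R M) (α : Fin r → ℕ) : Submodule R M :=
  (Ideal.span (Set.range x) ^ (∑ i, α i + 1) • ⊤ ⊔ Y) ⊔
    ⨆ β : Fin r → ℕ, ⨆ (_ : ∑ i, β i = ∑ i, α i), ⨆ (_ : toLex β < toLex α),
      LinearMap.range (LinearMap.lsmul R M (∏ i, x i ^ β i))

/-- The submodule of those `z` such that `x ^ α z` lies in `lexStep x Y α`. -/
noncomputable def lexColon (x : Fin r → R) (Y : Submodule R M) (α : Fin r → ℕ) : Submodule R M :=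
  (lexStep x Y α).comap (LinearMap.lsmul R M (∏ i, x i ^ α i))

theorem prod_pow_mem_pow_span (x : Fin r → R) (α : Fin r → ℕ) :
    ∏ i, x i ^ α i ∈ Ideal.span (Set.range x) ^ ∑ i, α i := by
  rw [← Finset.prod_pow_eq_pow_sum]
  exact Ideal.prod_mem_prod fun i _ =>
    Ideal.pow_mem_pow (Ideal.subset_span (Set.mem_range_self i)) _

theorem lexStep_add_le (x : Fin r → R) (Y : Submodule R M) (α γ : Fin r → ℕ) :
    lexStep x Y α ≤ (lexStep x Y (α + γ)).comap (LinearMap.lsmul R M (∏ i, x i ^ γ i)) := by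
  refine sup_le (sup_le ?_ ?_) ?_
  · rw [← Submodule.map_le_iff_le_comap]
    refine le_trans ?_ (le_sup_left.trans le_sup_left)
    rintro _ ⟨z, hz, rfl⟩
    have : (∏ i, x i ^ γ i) • z ∈ _ := Submodule.smul_mem_smul (prod_pow_mem_pow_span x γ) hz
    rw [← mul_smul, ← pow_add] at this
    have e : ∑ i, (α + γ) i + 1 = ∑ i, γ i + (∑ i, α i + 1) := by
      simp only [Pi.add_apply, Finset.sum_add_distrib]
      ring
    rw [e]
    exact this
  · intro z hz
    exact Submodule.mem_sup_left (Submodule.mem_sup_right (Y.smul_mem _ hz))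
  · refine iSup_le fun β => iSup_le fun hβ => iSup_le fun hlt => ?_
    rintro _ ⟨z, rfl⟩
    refine Submodule.mem_sup_right ?_
    refine Submodule.mem_iSup_of_mem (β + γ) (Submodule.mem_iSup_of_mem ?_
      (Submodule.mem_iSup_of_mem ?_ ⟨z, ?_⟩))
    · simp [Finset.sum_add_distrib, hβ]
    · exact add_lt_add_left hlt (toLex γ)
    · simp only [LinearMap.lsmul_apply, smul_smul, Pi.add_apply, pow_add, Finset.prod_mul_distrib]
      rw [mul_comm]

theorem lexColon_mono (x : Fin r → R) (Y : Submodule R M) : Monotone (lexColon x Y) := by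
  intro α α' h
  obtain ⟨γ, rfl⟩ : ∃ γ, α' = α + γ := ⟨α' - α, (add_tsub_cancel_of_le h).symm⟩
  intro z hz
  have := lexStep_add_le x Y α γ hz
  simp only [lexColon, Submodule.mem_comap, LinearMap.lsmul_apply, smul_smul] at this ⊢
  convert this using 2
  simp only [Pi.add_apply, pow_add, Finset.prod_mul_distrib]
  rw [mul_comm]

theorem span_smul_top_sup_le_lexColon (x : Fin r → R) (Y : Submodule R M) (α : Fin r → ℕ) :
    Ideal.span (Set.range x) • ⊤ ⊔ Y ≤ lexColon x Y α := by
  refine sup_le ?_ ?_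
  · intro z hz
    have := Submodule.smul_mem_smul (prod_pow_mem_pow_span x α) hz
    rw [← mul_smul, ← pow_succ] at this
    exact Submodule.mem_sup_left (Submodule.mem_sup_left this)
  · intro z hz
    exact Submodule.mem_sup_left (Submodule.mem_sup_right (Y.smul_mem _ hz))

theorem span_pow_eq_iSup (x : Fin r → R) (n : ℕ) :
    Ideal.span (Set.range x) ^ n =
      ⨆ α ∈ Finset.Nat.antidiagonalTuple r n, Ideal.span {∏ i, x i ^ α i} := by
  refine le_antisymm ?_ ?_
  · induction n with
    | zero =>
      refine le_trans ?_ (le_iSup₂_of_le 0 (by rw [Finset.Nat.antidiagonalTuple_zero_right]; simp) le_rfl)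
      simp
    | succ n ih =>
      rw [pow_succ]
      refine (Ideal.mul_mono_left ih).trans ?_
      simp only [Submodule.iSup_mul]
      refine iSup₂_le fun α hα => ?_
      rw [Ideal.span_mul_span', Ideal.span_le]
      rintro _ ⟨a, rfl, _, ⟨i, rfl⟩, rfl⟩
      refine Submodule.mem_iSup_of_mem (α + Pi.single i 1) (Submodule.mem_iSup_of_mem ?_ ?_)
      · rw [Finset.Nat.mem_antidiagonalTuple] at hα ⊢
        simp [Finset.sum_add_distrib, hα]
      · refine Ideal.mem_span_singleton'.2 ⟨1, ?_⟩
        simp only [Pi.add_apply, pow_add, Finset.prod_mul_distrib]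
        rw [one_mul, Finset.prod_eq_single (s := Finset.univ)
          (f := fun j => x j ^ (Pi.single i 1 : Fin r → ℕ) j) i]
        · simp
        · intro j _ hj; simp [hj]
        · simp
  · refine iSup₂_le fun α hα => ?_
    rw [Ideal.span_singleton_le_iff_mem, ← Finset.Nat.mem_antidiagonalTuple.1 hα]
    exact prod_pow_mem_pow_span x α

theorem span_pow_smul_top_eq_iSup (x : Fin r → R) (n : ℕ) :
    Ideal.span (Set.range x) ^ n • (⊤ : Submodule R M) =
      ⨆ α ∈ Finset.Nat.antidiagonalTuple r n,
        LinearMap.range (LinearMap.lsmul R M (∏ i, x i ^ α i)) := by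
  rw [span_pow_eq_iSup]
  simp only [Submodule.iSup_smul]
  refine iSup_congr fun α => iSup_congr fun _ => ?_
  rw [Submodule.ideal_span_singleton_smul]
  ext z
  simp [Submodule.mem_smul_pointwise_iff_exists]

theorem length_quotient_pow_succ (x : Fin r → R) (Y : Submodule R M) (n : ℕ) :
    Module.length R (M ⧸ (Ideal.span (Set.range x) ^ (n + 1) • ⊤ ⊔ Y)) =
      Module.length R (M ⧸ (Ideal.span (Set.range x) ^ n • ⊤ ⊔ Y)) +
        ∑ α ∈ Finset.Nat.antidiagonalTuple r n, Module.length R (M ⧸ lexColon x Y α) := by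
  rw [length_quotient_eq_add_sum (ι := Lex (Fin r → ℕ))
    (fun α => LinearMap.lsmul R M (∏ i, x i ^ ofLex α i)) _
    ((Finset.Nat.antidiagonalTuple r n).map toLex.toEmbedding)]
  congr 1
  · have : (⨆ β ∈ (Finset.Nat.antidiagonalTuple r n).map toLex.toEmbedding,
        LinearMap.range (LinearMap.lsmul R M (∏ i, x i ^ ofLex β i))) =
        Ideal.span (Set.range x) ^ n • (⊤ : Submodule R M) := by
      rw [span_pow_smul_top_eq_iSup]
      refine le_antisymm (iSup₂_le fun β hβ => ?_) (iSup₂_le fun α hα => ?_)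
      · obtain ⟨α, hα, rfl⟩ := Finset.mem_map.1 hβ
        exact le_iSup₂_of_le α hα le_rfl
      · exact le_iSup₂_of_le (toLex α) (Finset.mem_map.2 ⟨α, hα, rfl⟩) le_rfl
    rw [this, sup_right_comm, sup_eq_right.2
      (Submodule.smul_mono_left (Ideal.pow_le_pow_right n.le_succ) :
        Ideal.span (Set.range x) ^ (n + 1) • (⊤ : Submodule R M) ≤ _)]
  · rw [Finset.sum_map]
    refine Finset.sum_congr rfl fun α hα => ?_
    rw [Finset.Nat.mem_antidiagonalTuple] at hα
    have e : lexColon x Y α = (Ideal.span (Set.range x) ^ (n + 1) • ⊤ ⊔ Y ⊔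
        ⨆ β ∈ (Finset.Nat.antidiagonalTuple r n).map toLex.toEmbedding, ⨆ (_ : β < toLex α),
          LinearMap.range (LinearMap.lsmul R M (∏ i, x i ^ ofLex β i))).comap
        (LinearMap.lsmul R M (∏ i, x i ^ α i)) := by
      simp only [lexColon, lexStep, hα]
      congr 2
      refine le_antisymm (iSup_le fun β => iSup_le fun hβ => iSup_le fun hlt => ?_)
        (iSup_le fun β => iSup_le fun hβ => iSup_le fun hlt => ?_)
      · exact le_iSup₂_of_le (toLex β) (Finset.mem_map.2
          ⟨β, Finset.Nat.mem_antidiagonalTuple.2 hβ, rfl⟩) (le_iSup_of_le hlt le_rfl)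
      · obtain ⟨β, hβ', rfl⟩ := Finset.mem_map.1 hβ
        exact le_iSup₂_of_le β (Finset.Nat.mem_antidiagonalTuple.1 hβ') (le_iSup_of_le hlt le_rfl)
    rw [e]
    rfl

end Monomial

theorem exists_antitone_length_eq_simplexSum {R M : Type*} [CommRing R] [AddCommGroup M]
    [Module R M] {r : ℕ} (x : Fin r → R) (Y : Submodule R M)
    (hfin : Module.length R (M ⧸ (Ideal.span (Set.range x) • ⊤ ⊔ Y)) ≠ ⊤) :
    ∃ h : (Fin r → ℕ) → ℕ, Antitone h ∧ ∀ n : ℕ,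
      Module.length R (M ⧸ (Ideal.span (Set.range x) ^ (n + 1) • ⊤ ⊔ Y)) =
        (simplexSum r h n : ℕ∞) := by
  have hne : ∀ α, Module.length R (M ⧸ lexColon x Y α) ≠ ⊤ := fun α =>
    ne_top_of_le_ne_top hfin (length_quotient_anti (span_smul_top_sup_le_lexColon x Y α))
  refine ⟨fun α => (Module.length R (M ⧸ lexColon x Y α)).toNat, fun α β h =>
    ENat.toNat_le_toNat (length_quotient_anti (lexColon_mono x Y h)) (hne _), fun n => ?_⟩
  rw [simplexSum_eq_sum_antidiagonalTuple]
  push_cast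
  simp only [ENat.natCast_toNat (hne _)]
  induction n with
  | zero =>
    rw [length_quotient_pow_succ, pow_zero, Ideal.one_eq_top, Submodule.top_smul, top_sup_eq,
      Module.length_eq_zero]
    simp
  | succ n ih => rw [length_quotient_pow_succ, ih, Finset.sum_range_succ _ (n + 1)]

section LocalAlgebra

variable {R : Type*} [CommRing R] [IsLocalRing R] [IsNoetherianRing R]

theorem exists_fin_maximalIdeal_pow_le_span_sup {I : Ideal R} {d : ℕ}
    (hd : ringKrullDim (R ⧸ I) = d) :
    ∃ x : Fin d → R, (∀ i, x i ∈ maximalIdeal R) ∧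
      ∃ a, maximalIdeal R ^ a ≤ Ideal.span (Set.range x) ⊔ I := by
  have : Nontrivial (R ⧸ I) := by
    by_contra h
    rw [not_nontrivial_iff_subsingleton] at h
    rw [ringKrullDim_eq_bot_of_subsingleton] at hd
    exact WithBot.bot_ne_coe hd
  have : IsLocalRing (R ⧸ I) := .of_surjective' (Ideal.Quotient.mk I) Ideal.Quotient.mk_surjective
  have hloc : IsLocalHom (Ideal.Quotient.mk I) :=
    .of_surjective _ Ideal.Quotient.mk_surjective
  obtain ⟨s, hs, hcard⟩ :=
    (maximalIdeal (R ⧸ I)).exists_finset_card_eq_height_of_isNoetherianRing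
  replace hcard : s.card = d := by
    rw [← IsLocalRing.maximalIdeal_height_eq_ringKrullDim, ← hcard] at hd
    exact_mod_cast hd
  have := IsLocalRing.quotient_artinian_of_mem_minimalPrimes_of_isLocalRing _ hs
  obtain ⟨a, ha⟩ :=
    IsLocalRing.exists_maximalIdeal_pow_le_of_isArtinianRing_quotient (Ideal.span (s : Set (R ⧸ I)))
  choose g hg using Ideal.Quotient.mk_surjective (I := I)
  let e := s.equivFinOfCardEq hcard
  have hrange : Ideal.Quotient.mk I '' Set.range (fun i => g (e.symm i)) = s := by
    rw [← Set.range_comp]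
    ext y
    simp only [Set.mem_range, Function.comp_apply, hg]
    exact ⟨by rintro ⟨i, rfl⟩; exact (e.symm i).2, fun hy => ⟨e ⟨y, hy⟩, by simp⟩⟩
  refine ⟨fun i => g (e.symm i), fun i => ?_, a, ?_⟩
  · have : Ideal.Quotient.mk I (g (e.symm i)) ∈ maximalIdeal (R ⧸ I) := by
      rw [hg]
      exact hs.1.2 (Ideal.subset_span (e.symm i).2)
    rw [mem_maximalIdeal, mem_nonunits_iff] at this ⊢
    exact fun h => this (h.map _)
  · have h1 : (maximalIdeal R ^ a).map (Ideal.Quotient.mk I) ≤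
        (Ideal.span (Set.range fun i => g (e.symm i))).map (Ideal.Quotient.mk I) := by
      rw [Ideal.map_span, hrange, Ideal.map_pow]
      exact (Ideal.pow_right_mono (((local_hom_TFAE (Ideal.Quotient.mk I)).out 0 2).1
        hloc) a).trans ha
    rw [Ideal.map_le_iff_le_comap, Ideal.comap_map_of_surjective _ Ideal.Quotient.mk_surjective]
      at h1
    rwa [← RingHom.ker_eq_comap_bot, Ideal.mk_ker] at h1

theorem length_quotient_ne_top_of_pow_smul_le {M : Type*} [AddCommGroup M] [Module R M]
    [Module.Finite R M] {W : Submodule R M} {a : ℕ}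
    (h : maximalIdeal R ^ a • (⊤ : Submodule R M) ≤ W) : Module.length R (M ⧸ W) ≠ ⊤ := by
  have hann : Module.IsTorsionBySet R (M ⧸ W) ↑(maximalIdeal R ^ (a + 1)) := by
    rw [Module.isTorsionBySet_quotient_iff]
    exact fun y z hz => h (Submodule.smul_mem_smul (Ideal.pow_le_pow_right a.le_succ hz) trivial)
  have hart : IsArtinianRing (R ⧸ maximalIdeal R ^ (a + 1)) := by
    refine IsLocalRing.quotient_artinian_of_mem_minimalPrimes_of_isLocalRing _
      ⟨⟨inferInstance, Ideal.pow_le_self a.succ_ne_zero⟩, fun q hq _ => ?_⟩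
    have := hq.1
    exact Ideal.IsPrime.le_of_pow_le hq.2
  let := hann.module
  have : IsScalarTower R (R ⧸ maximalIdeal R ^ (a + 1)) (M ⧸ W) := hann.isScalarTower
  have : Module.Finite (R ⧸ maximalIdeal R ^ (a + 1)) (M ⧸ W) :=
    Module.Finite.of_restrictScalars_finite R _ _
  rw [Module.length_eq_of_surjective (R := R ⧸ maximalIdeal R ^ (a + 1))
    Ideal.Quotient.mk_surjective]
  exact Module.length_ne_top

theorem exists_comap_pow_smul_le {R M P : Type*} [CommRing R] [IsNoetherianRing R]
    [AddCommGroup M] [Module R M] [Module.Finite R M] [AddCommGroup P] [Module R P]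
    (I : Ideal R) (φ : P →ₗ[R] M) :
    ∃ c, ∀ n ≥ c, (I ^ n • (⊤ : Submodule R M)).comap φ ≤
      I ^ (n - c) • (⊤ : Submodule R P) ⊔ LinearMap.ker φ := by
  obtain ⟨k, hk⟩ := Ideal.exists_pow_inf_eq_pow_smul I (LinearMap.range φ)
  refine ⟨k, fun n hn => ?_⟩
  rw [← Submodule.comap_map_eq, Submodule.map_smul'', Submodule.map_top]
  intro y hy
  have : φ y ∈ I ^ n • (⊤ : Submodule R M) ⊓ LinearMap.range φ := ⟨hy, y, rfl⟩
  rw [hk n hn] at this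
  exact Submodule.smul_mono le_rfl inf_le_right this

end LocalAlgebra

theorem succ_pow_succ_le (x d : ℕ) : (x + 1) ^ (d + 1) ≤ x ^ (d + 1) + (d + 1) * (x + 1) ^ d := by
  induction d with
  | zero => simp
  | succ d ih =>
    have h1 : x ^ (d + 1) ≤ (x + 1) ^ (d + 1) := Nat.pow_le_pow_left x.le_succ _
    calc (x + 1) ^ (d + 1 + 1) = (x + 1) ^ (d + 1) * (x + 1) := pow_succ _ _
      _ ≤ (x ^ (d + 1) + (d + 1) * (x + 1) ^ d) * (x + 1) := Nat.mul_le_mul_right _ ih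
      _ = x ^ (d + 1 + 1) + x ^ (d + 1) + (d + 1) * (x + 1) ^ (d + 1) := by ring
      _ ≤ x ^ (d + 1 + 1) + (d + 1 + 1) * (x + 1) ^ (d + 1) := by linarith

theorem exists_succ_pow_succ_le_mul {h h₁ : ℕ → ℕ} (hmono : Monotone h) (hpos : 0 < h 0)
    {a c d : ℕ} (hc : 0 < c) (h₁_le : ∀ n, (n + 1) ^ d ≤ a * h₁ n)
    (hstep : ∀ n, h₁ (n + c) + h n ≤ h (n + c)) :
    ∃ b, ∀ n, (n + 1) ^ (d + 1) ≤ b * h n := by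
  have key : ∀ m, (m + 1) ^ (d + 1) ≤ ((d + 1) * a + 1) * h (c * m) := by
    intro m
    induction m with
    | zero =>
      simpa using Nat.one_le_iff_ne_zero.2 (Nat.mul_ne_zero (Nat.succ_ne_zero _) hpos.ne')
    | succ m ih =>
      have h2 : (m + 1 + 1) ^ d ≤ (c * m + c + 1) ^ d :=
        Nat.pow_le_pow_left (by nlinarith) _
      have h3 := h₁_le (c * m + c)
      have h4 := hstep (c * m)
      have h5 := succ_pow_succ_le (m + 1) d
      rw [Nat.mul_succ]
      calc (m + 1 + 1) ^ (d + 1) ≤ (m + 1) ^ (d + 1) + (d + 1) * (m + 1 + 1) ^ d := h5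
        _ ≤ ((d + 1) * a + 1) * h (c * m) + (d + 1) * (a * h₁ (c * m + c)) :=
          Nat.add_le_add ih (Nat.mul_le_mul_left _ (h2.trans h3))
        _ ≤ ((d + 1) * a + 1) * (h₁ (c * m + c) + h (c * m)) := by nlinarith
        _ ≤ _ := Nat.mul_le_mul_left _ h4
  refine ⟨c ^ (d + 1) * ((d + 1) * a + 1), fun n => ?_⟩
  calc (n + 1) ^ (d + 1) ≤ (c * (n / c + 1)) ^ (d + 1) :=
        Nat.pow_le_pow_left (Nat.lt_mul_div_succ n hc) _
    _ = c ^ (d + 1) * (n / c + 1) ^ (d + 1) := mul_pow _ _ _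
    _ ≤ c ^ (d + 1) * (((d + 1) * a + 1) * h (c * (n / c))) := Nat.mul_le_mul_left _ (key _)
    _ ≤ c ^ (d + 1) * (((d + 1) * a + 1) * h n) := by
      gcongr
      exact hmono (Nat.mul_div_le n c)
    _ = _ := by ring

section LocalAlgebra

variable {R : Type*} [CommRing R] [IsLocalRing R] [IsNoetherianRing R]

theorem length_quotient_ne_top_of_pow_le {I : Ideal R} {a : ℕ} (h : maximalIdeal R ^ a ≤ I) :
    Module.length R (R ⧸ I) ≠ ⊤ :=
  length_quotient_ne_top_of_pow_smul_le (a := a) (by rwa [smul_eq_mul, Ideal.mul_top])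

theorem exists_succ_pow_le_mul_length_quotient (d : ℕ) (p : PrimeSpectrum R)
    (hp : d ≤ Order.coheight p) :
    ∃ a : ℕ, ∀ n, (n + 1) ^ d ≤
      a * (Module.length R (R ⧸ (maximalIdeal R ^ (n + 1) ⊔ p.asIdeal))).toNat := by
  have hfin (q : PrimeSpectrum R) (n : ℕ) :
      Module.length R (R ⧸ (maximalIdeal R ^ (n + 1) ⊔ q.asIdeal)) ≠ ⊤ :=
    length_quotient_ne_top_of_pow_le le_sup_left
  have hpos (q : PrimeSpectrum R) (n : ℕ) :
      0 < (Module.length R (R ⧸ (maximalIdeal R ^ (n + 1) ⊔ q.asIdeal))).toNat := by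
    rw [pos_iff_ne_zero, Ne, ENat.toNat_eq_zero, not_or]
    refine ⟨?_, hfin q n⟩
    rw [← Ne, ← pos_iff_ne_zero, Module.length_pos_iff, Ideal.Quotient.nontrivial_iff]
    exact ne_top_of_le_ne_top (maximalIdeal.isMaximal R).ne_top
      (sup_le (Ideal.pow_le_self n.succ_ne_zero) (le_maximalIdeal q.2.ne_top))
  induction d generalizing p with
  | zero => exact ⟨1, fun n => by simpa using Nat.one_le_iff_ne_zero.2 (hpos p n).ne'⟩
  | succ d ih =>
    obtain ⟨q, hpq, hq⟩ : ∃ q > p, d ≤ Order.coheight q := by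
      by_contra! h
      have := (hp.trans (Order.coheight_le_coe_iff.2 h))
      norm_cast at this
      omega
    obtain ⟨a, ha⟩ := ih q hq
    obtain ⟨x, hxq, hxp⟩ := SetLike.exists_of_lt (p := p.asIdeal) (q := q.asIdeal) hpq
    obtain ⟨c, hc⟩ := exists_comap_pow_smul_le (maximalIdeal R)
      (p.asIdeal.mkQ ∘ₗ LinearMap.mulLeft R x)
    have hker : LinearMap.ker (p.asIdeal.mkQ ∘ₗ LinearMap.mulLeft R x) = p.asIdeal := by
      ext y
      rw [LinearMap.mem_ker, LinearMap.comp_apply, LinearMap.mulLeft_apply, Submodule.mkQ_apply,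
        Submodule.Quotient.mk_eq_zero]
      exact ⟨fun h => (p.2.mem_or_mem h).resolve_left hxp, fun h => Ideal.mul_mem_left _ _ h⟩
    refine exists_succ_pow_succ_le_mul (c := c + 1) (fun m n hmn => ?_) (hpos p 0) c.succ_pos ha
      fun n => ?_
    · exact ENat.toNat_le_toNat (length_quotient_anti
        (sup_le_sup_right (Ideal.pow_le_pow_right (by omega)) _)) (hfin p n)
    · rw [← Nat.cast_le (α := ℕ∞), Nat.cast_add, ENat.natCast_toNat (hfin _ _),
        ENat.natCast_toNat (hfin _ _), ENat.natCast_toNat (hfin _ _),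
        length_quotient_eq_add_comap (LinearMap.mulLeft R x)
          (maximalIdeal R ^ (n + (c + 1) + 1) ⊔ p.asIdeal)]
      gcongr
      · refine length_quotient_anti (sup_le (sup_le_sup_left hpq.le _) ?_)
        rintro _ ⟨y, rfl⟩
        exact Ideal.mem_sup_right (Ideal.mul_mem_right _ _ hxq)
      · refine length_quotient_anti ?_
        have h1 := hc (n + (c + 1) + 1) (by omega)
        rw [hker, smul_eq_mul, Ideal.mul_top] at h1
        refine le_trans ?_ (h1.trans (sup_le_sup_right (Ideal.pow_le_pow_right (by omega)) _))
        rw [Submodule.comap_comp]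
        refine Submodule.comap_mono (sup_le ?_ ?_)
        · rw [← Submodule.map_le_iff_le_comap]
          nth_rw 1 [← Ideal.mul_top (maximalIdeal R ^ (n + (c + 1) + 1))]
          rw [← smul_eq_mul, Submodule.map_smul'']
          exact Submodule.smul_mono le_rfl le_top
        · intro y hy
          rw [Submodule.mem_comap, Submodule.mkQ_apply, (Submodule.Quotient.mk_eq_zero _).2 hy]
          exact zero_mem _

end LocalAlgebra

theorem coheight_le_ringKrullDim_quotient {R : Type*} [CommRing R] {I : Ideal R}
    {p : PrimeSpectrum R} (h : I ≤ p.asIdeal) :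
    (Order.coheight p : WithBot ℕ∞) ≤ ringKrullDim (R ⧸ I) := by
  rw [ringKrullDim_quotient, Order.coheight_eq_krullDim_Ici]
  exact Order.krullDim_le_of_strictMono
    (fun q : Set.Ici p => (⟨q.1, h.trans q.2⟩ : PrimeSpectrum.zeroLocus (R := R) I))
    fun _ _ hq => hq

theorem exists_minimalPrimes_le_coheight {R : Type*} [CommRing R] {I : Ideal R} {d : ℕ}
    (h : (d : WithBot ℕ∞) ≤ ringKrullDim (R ⧸ I)) :
    ∃ p : PrimeSpectrum R, p.asIdeal ∈ I.minimalPrimes ∧ d ≤ Order.coheight p := by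
  rw [ringKrullDim_quotient, Order.le_krullDim_iff] at h
  obtain ⟨l, rfl⟩ := h
  obtain ⟨p, hp, hpl⟩ := Ideal.exists_minimalPrimes_le (J := l.head.1.asIdeal) l.head.2
  refine ⟨⟨p, hp.1.1⟩, hp, ?_⟩
  exact (Order.length_le_coheight_head (p := l.map Subtype.val fun _ _ h => h)).trans
    (Order.coheight_anti hpl)

theorem exists_mDim_lt_annihilator_le {R M : Type} [CommRing R] [IsNoetherianRing R]
    [AddCommGroup M] [Module R M] [Module.Finite R M] {p : Ideal R} [p.IsPrime]
    (h : Submodule.annihilator (⊤ : Submodule R ↥(unmixedComp R M)) ≤ p) :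
    ∃ N : Submodule R M, mDim R N < mDim R M ∧
      Submodule.annihilator (⊤ : Submodule R N) ≤ p := by
  obtain ⟨s, hs, hsup⟩ := (CompleteLattice.isCompactElement_iff_exists_le_sSup_of_le_sSup _
    (unmixedComp R M)).1 ((Submodule.fg_iff_compact _).1 (IsNoetherian.noetherian _)) _ le_rfl
  have h1 : s.inf Submodule.annihilator ≤ p := by
    refine le_trans (fun a ha => ?_) h
    rw [Submodule.annihilator_top, ← Submodule.annihilator, Submodule.mem_annihilator]
    have : s.sup id ≤ LinearMap.ker (LinearMap.lsmul R M a) := by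
      refine Finset.sup_le fun N hN y hy => ?_
      exact Submodule.mem_annihilator.1 (Finset.inf_le (f := Submodule.annihilator) hN ha) y hy
    exact fun y hy => this (hsup hy)
  obtain ⟨N, hN, hNp⟩ := (Ideal.IsPrime.inf_le' ‹_›).1 h1
  exact ⟨N, hs hN, by rwa [Submodule.annihilator_top]⟩

theorem exists_mem_associatedPrimes_coheight_eq {R M : Type} [CommRing R] [IsNoetherianRing R]
    [AddCommGroup M] [Module R M] [Module.Finite R M] {d : ℕ} (hd : mDim R M = (d + 2 : ℕ))
    (h : ¬ mDim R ↥(unmixedComp R M) ≤ d) :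
    ∃ p : PrimeSpectrum R, p.asIdeal ∈ associatedPrimes R M ∧
      Order.coheight p = (d + 1 : ℕ) := by
  have h1 : ((d + 1 : ℕ) : WithBot ℕ∞) ≤ mDim R ↥(unmixedComp R M) := by
    push_cast
    exact ENat.WithBot.add_one_le_iff.2 (not_le.1 h)
  obtain ⟨p, hp, hdp⟩ := exists_minimalPrimes_le_coheight h1
  obtain ⟨N, hN, hNp⟩ := exists_mDim_lt_annihilator_le hp.1.2
  refine ⟨p, associatedPrimes.subset_of_injective (unmixedComp R M).injective_subtype
    (Module.associatedPrimes.minimalPrimes_annihilator_subset_associatedPrimes R _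
      (by rwa [Submodule.annihilator_top] at hp)), le_antisymm ?_ hdp⟩
  have h2 : (Order.coheight p : WithBot ℕ∞) < (d + 1 + 1 : ℕ) :=
    (coheight_le_ringKrullDim_quotient hNp).trans_lt (hN.trans_eq hd)
  have h3 : Order.coheight p < (d + 1 : ℕ) + 1 := by exact_mod_cast h2
  exact Order.le_of_lt_add_one h3

theorem exists_coeffs_of_simplexSum_eq_add {d : ℕ} {h h' : (Fin (d + 1) → ℕ) → ℕ}
    (hh : Antitone h) (hh' : Antitone h') {D : ℕ → ℕ}
    (hD : ∀ n, simplexSum (d + 1) h n = simplexSum (d + 1) h' n + D n) {A B k : ℕ}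
    (hle : ∀ n, D n ≤ B * (n + 1) ^ d)
    (hge : ∀ᶠ n in atTop, (k * (n + 1)) ^ d ≤ A * D n) :
    ∃ s : ℕ → ℤ, (∀ᶠ n in atTop, (simplexSum (d + 1) h n : ℤ) =
        ∑ i ∈ Finset.range (d + 1 + 1),
          (-1) ^ i * s i * ((n + (d + 1) - i).choose (d + 1 - i) : ℤ)) ∧
      (k ^ d * d.factorial : ℤ) ≤ A * -s 1 := by
  obtain ⟨c, hc, -⟩ := isPolyType_simplexSum (d + 1) h hh
  obtain ⟨c', hc', hc'_le⟩ := isPolyType_simplexSum (d + 1) h' hh'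
  have hcc : (c : ℤ) = c' := by
    have h1 := (hc.add hc'.neg).tendsto_div_pow
    have h2 : Tendsto (fun n : ℕ => ((D n : ℕ) : ℝ) / ((n : ℝ) + 1) ^ (d + 1)) atTop (𝓝 0) := by
      have h3 : Tendsto (fun n : ℕ => (B : ℝ) * (1 / ((n : ℝ) + 1))) atTop (𝓝 0) := by
        simpa using tendsto_one_div_add_atTop_nhds_zero_nat.const_mul (B : ℝ)
      refine squeeze_zero (fun n => by positivity) (fun n => ?_) h3
      have hn : (0 : ℝ) < (n : ℝ) + 1 := by positivity
      rw [div_le_iff₀ (by positivity), pow_succ]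
      have h4 : (D n : ℝ) ≤ B * ((n : ℝ) + 1) ^ d := by exact_mod_cast hle n
      calc (D n : ℝ) ≤ B * ((n : ℝ) + 1) ^ d := h4
        _ = B * (1 / ((n : ℝ) + 1)) * (((n : ℝ) + 1) ^ d * ((n : ℝ) + 1)) := by
          field_simp
    have h5 := tendsto_nhds_unique (h1.congr fun n => by simp [hD n]) h2
    rw [div_eq_zero_iff] at h5
    have h6 := h5.resolve_right (by positivity)
    push_cast at h6
    have : (c : ℝ) = c' := by linarith
    exact_mod_cast this
  obtain ⟨s, hs0, hs⟩ := hc.exists_coeffs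
  refine ⟨s, hs, ?_⟩
  have hlim := tendsto_binomial_sum_div_pow d (fun i => -s (i + 1))
  have hle : ∀ᶠ n : ℕ in atTop, (k : ℝ) ^ d ≤
      A * (((∑ i ∈ Finset.range (d + 1), (-1) ^ i * -s (i + 1) *
        ((n + d - i).choose (d - i) : ℤ) : ℤ) : ℝ) / ((n : ℝ) + 1) ^ d) := by
    filter_upwards [hs, hge] with n hn hgen
    have h1 : c' * (n + (d + 1)).choose (d + 1) ≤ simplexSum (d + 1) h' n := by
      rw [← simplexSum_const]
      exact simplexSum_mono _ hc'_le n
    have h2 : (∑ i ∈ Finset.range (d + 1), (-1) ^ i * -s (i + 1) *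
        ((n + d - i).choose (d - i) : ℤ)) =
          simplexSum (d + 1) h n - c' * ((n + (d + 1)).choose (d + 1) : ℤ) := by
      rw [hn, Finset.sum_range_succ' _ (d + 1), pow_zero, one_mul, hs0, hcc, tsub_zero, tsub_zero,
        add_sub_cancel_right]
      refine Finset.sum_congr rfl fun i _ => ?_
      rw [show n + (d + 1) - (i + 1) = n + d - i by omega, show d + 1 - (i + 1) = d - i by omega]
      ring
    have h3 : (D n : ℤ) ≤ ∑ i ∈ Finset.range (d + 1), (-1) ^ i * -s (i + 1) *
        ((n + d - i).choose (d - i) : ℤ) := by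
      rw [h2, hD n]
      push_cast
      have : ((c' * (n + (d + 1)).choose (d + 1) : ℕ) : ℤ) ≤ simplexSum (d + 1) h' n := by
        exact_mod_cast h1
      push_cast at this
      linarith
    have h4 : (k : ℝ) ^ d * ((n : ℝ) + 1) ^ d ≤ A * D n := by
      rw [← mul_pow]
      exact_mod_cast hgen
    rw [← mul_div_assoc, le_div_iff₀ (by positivity)]
    refine h4.trans (mul_le_mul_of_nonneg_left ?_ A.cast_nonneg)
    exact_mod_cast h3
  have hfin := ge_of_tendsto (hlim.const_mul (A : ℝ)) hle
  rw [← mul_div_assoc, le_div_iff₀ (by positivity)] at hfin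
  exact_mod_cast hfin

theorem Ideal.sup_pow_le {R : Type*} [CommRing R] (I J : Ideal R) (n : ℕ) :
    (I ⊔ J) ^ n ≤ I ^ n ⊔ J := by
  have h : ((I ⊔ J) ^ n).map (Ideal.Quotient.mk J) ≤ (I ^ n).map (Ideal.Quotient.mk J) := by
    rw [Ideal.map_pow, Ideal.map_sup, Ideal.map_quotient_self, sup_bot_eq, Ideal.map_pow]
  rwa [Ideal.map_le_iff_le_comap, Ideal.comap_map_of_surjective _ Ideal.Quotient.mk_surjective,
    ← RingHom.ker_eq_comap_bot, Ideal.mk_ker] at h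

theorem length_quotient_span_pow_sup_le {R : Type*} [CommRing R] {d : ℕ} {y : Fin d → R}
    {I : Ideal R} (hfin : Module.length R (R ⧸ (Ideal.span (Set.range y) ⊔ I)) ≠ ⊤) :
    ∃ B : ℕ, ∀ n, Module.length R (R ⧸ (Ideal.span (Set.range y) ^ (n + 1) ⊔ I)) ≤
      ((B * (n + d).choose d : ℕ) : ℕ∞) := by
  obtain ⟨g, hg, hgl⟩ := exists_antitone_length_eq_simplexSum y I
    (by rwa [smul_eq_mul, Ideal.mul_top])
  refine ⟨g 0, fun n => ?_⟩
  have h := hgl n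
  rw [smul_eq_mul, Ideal.mul_top] at h
  rw [h, ← simplexSum_const]
  exact_mod_cast simplexSum_mono d (fun α => hg (fun i => Nat.zero_le (α i))) n

section LocalAlgebra

variable {R M : Type*} [CommRing R] [IsLocalRing R] [IsNoetherianRing R]
  [AddCommGroup M] [Module R M] [Module.Finite R M]

theorem length_quotient_smul_top_ne_top {Q : Ideal R} {b : ℕ}
    (hb : maximalIdeal R ^ b ≤ Q ⊔ Module.annihilator R M) :
    Module.length R (M ⧸ Q • (⊤ : Submodule R M)) ≠ ⊤ := by
  refine length_quotient_ne_top_of_pow_smul_le (a := b) ((Submodule.smul_mono_left hb).trans ?_)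
  rw [Submodule.sup_smul, ← Submodule.annihilator_top, Submodule.annihilator_smul, sup_bot_eq]

theorem exists_coeffs_of_le_maximalIdeal_pow {d a b k : ℕ} {x : Fin (d + 1) → R}
    {p : Ideal R} {φ : R →ₗ[R] M} (hφ : LinearMap.ker φ = p) {y : Fin d → R}
    (hy : ∀ i, y i ∈ maximalIdeal R) {b' : ℕ}
    (hyp : maximalIdeal R ^ b' ≤ Ideal.span (Set.range y) ⊔ p)
    (ha : ∀ n, (n + 1) ^ d ≤
      a * (Module.length R (R ⧸ (maximalIdeal R ^ (n + 1) ⊔ p))).toNat)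
    (hx : maximalIdeal R ^ b ≤ Ideal.span (Set.range x) ⊔ Module.annihilator R M)
    (hk : 0 < k) (hxk : Ideal.span (Set.range x) ≤ maximalIdeal R ^ k) :
    ∃ s : ℕ → ℤ, (∀ᶠ n in atTop, ∃ l : ℕ,
        Module.length R (M ⧸ Ideal.span (Set.range x) ^ (n + 1) • (⊤ : Submodule R M)) = l ∧
        (l : ℤ) = ∑ i ∈ Finset.range (d + 1 + 1),
          (-1) ^ i * s i * ((n + (d + 1) - i).choose (d + 1 - i) : ℤ)) ∧
      (k ^ d * d.factorial : ℤ) ≤ (2 ^ d * a : ℕ) * -s 1 := by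
  have hfin := length_quotient_smul_top_ne_top hx
  have hann : Module.annihilator R M ≤ p := by
    intro z hz
    rw [← hφ, LinearMap.mem_ker, ← mul_one z, ← smul_eq_mul, map_smul]
    exact Module.mem_annihilator.1 hz _
  obtain ⟨h, hh, hhl⟩ := exists_antitone_length_eq_simplexSum x (⊥ : Submodule R M)
    (by rwa [sup_bot_eq])
  obtain ⟨h', hh', hhl'⟩ := exists_antitone_length_eq_simplexSum x (LinearMap.range φ)
    (ne_top_of_le_ne_top hfin (length_quotient_anti le_sup_left))
  conv at hhl => intro n; rw [sup_bot_eq]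
  set Q := Ideal.span (Set.range x)
  have hadd (n : ℕ) := length_quotient_eq_add_comap φ (Q ^ (n + 1) • ⊤)
  simp only [hhl, hhl'] at hadd
  have hDfin (n : ℕ) :
      Module.length R (R ⧸ (Q ^ (n + 1) • (⊤ : Submodule R M)).comap φ) ≠ ⊤ := by
    refine ne_top_of_le_ne_top (ENat.natCast_ne_top (simplexSum (d + 1) h n)) ?_
    rw [hadd n]
    exact le_add_self
  choose D hD using fun n => ENat.ne_top_iff_exists.1 (hDfin n)
  simp only [← hD] at hadd
  -- the upper bound for the length of the image of `φ`
  have hyfin := length_quotient_ne_top_of_pow_le hyp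
  obtain ⟨B, hB⟩ := length_quotient_span_pow_sup_le hyfin
  have hle (n : ℕ) : D n ≤ B * (b + d) ^ d * (n + 1) ^ d := by
    have h1 : Ideal.span (Set.range y) ^ (b * (n + 1) + 1) ⊔ p ≤
        (Q ^ (n + 1) • (⊤ : Submodule R M)).comap φ := by
      refine sup_le ?_ (by rw [← hφ]; exact LinearMap.ker_le_comap φ)
      calc Ideal.span (Set.range y) ^ (b * (n + 1) + 1)
          ≤ Ideal.span (Set.range y) ^ (b * (n + 1)) := Ideal.pow_le_pow_right (Nat.le_succ _)
        _ ≤ maximalIdeal R ^ (b * (n + 1)) :=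
          Ideal.pow_right_mono (Ideal.span_le.2 (by rintro _ ⟨i, rfl⟩; exact hy i)) _
        _ = (maximalIdeal R ^ b) ^ (n + 1) := pow_mul _ _ _
        _ ≤ (Q ⊔ p) ^ (n + 1) := Ideal.pow_right_mono (hx.trans (sup_le_sup_left hann _)) _
        _ ≤ Q ^ (n + 1) ⊔ p := Ideal.sup_pow_le _ _ _
        _ ≤ _ := by
          refine sup_le ?_ (by rw [← hφ]; exact LinearMap.ker_le_comap φ)
          rw [← Submodule.map_le_iff_le_comap]
          nth_rw 1 [← Ideal.mul_top (Q ^ (n + 1))]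
          rw [← smul_eq_mul, Submodule.map_smul'']
          exact Submodule.smul_mono le_rfl le_top
    have h2 := (length_quotient_anti h1).trans (hB _)
    rw [← hD, Nat.cast_le] at h2
    refine h2.trans ?_
    rw [mul_assoc, ← mul_pow]
    gcongr
    refine (Nat.choose_le_pow _ _).trans (Nat.pow_le_pow_left ?_ _)
    nlinarith
  obtain ⟨c, hc⟩ := exists_comap_pow_smul_le Q φ
  have hge : ∀ᶠ n in atTop, (k * (n + 1)) ^ d ≤ 2 ^ d * a * D n := by
    filter_upwards [eventually_ge_atTop (2 * c)] with n hn
    have h1 := hc (n + 1) (by omega)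
    rw [smul_eq_mul, Ideal.mul_top, hφ] at h1
    obtain ⟨m, hm⟩ : ∃ m, k * (n + 1 - c) = m + 1 :=
      Nat.exists_eq_succ_of_ne_zero (Nat.mul_ne_zero hk.ne' (by omega))
    have h2 : (Q ^ (n + 1) • (⊤ : Submodule R M)).comap φ ≤ maximalIdeal R ^ (m + 1) ⊔ p := by
      refine h1.trans (sup_le_sup_right ?_ _)
      rw [← hm, pow_mul]
      exact Ideal.pow_right_mono hxk _
    have h3 := length_quotient_anti h2
    rw [← hD] at h3
    have h4 := ENat.toNat_le_toNat h3 (ENat.natCast_ne_top _)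
    rw [ENat.toNat_natCast] at h4
    calc (k * (n + 1)) ^ d ≤ (2 * (m + 1)) ^ d := by
          refine Nat.pow_le_pow_left ?_ _
          rw [← hm, ← mul_assoc, mul_comm 2, mul_assoc]
          exact Nat.mul_le_mul_left _ (by omega)
      _ = 2 ^ d * (m + 1) ^ d := mul_pow _ _ _
      _ ≤ 2 ^ d * (a * D n) :=
        Nat.mul_le_mul_left _ ((ha m).trans (Nat.mul_le_mul_left _ h4))
      _ = _ := (mul_assoc _ _ _).symm
  obtain ⟨s, hs, hs1⟩ := exists_coeffs_of_simplexSum_eq_add hh hh'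
    (fun n => by exact_mod_cast hadd n) hle hge
  exact ⟨s, hs.mono fun n hn => ⟨_, hhl n, hn⟩, hs1⟩

theorem exists_maximalIdeal_pow_le_span_pow_sup {ι : Type*} {x : ι → R} {I : Ideal R} {a : ℕ}
    (h : maximalIdeal R ^ a ≤ Ideal.span (Set.range x) ⊔ I) {k : ℕ} :
    ∃ b, maximalIdeal R ^ b ≤ Ideal.span (Set.range fun i => x i ^ k) ⊔ I := by
  have h1 : Ideal.span (Set.range x) ⊔ I ≤
      (Ideal.span (Set.range fun i => x i ^ k) ⊔ I).radical := by
    refine sup_le (Ideal.span_le.2 ?_) (le_sup_right.trans Ideal.le_radical)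
    rintro _ ⟨i, rfl⟩
    exact ⟨k, Ideal.mem_sup_left (Ideal.subset_span ⟨i, rfl⟩)⟩
  obtain ⟨N, hN⟩ := Ideal.exists_pow_le_of_le_radical_of_fg h1 (IsNoetherian.noetherian _)
  exact ⟨a * N, by rw [pow_mul]; exact (Ideal.pow_right_mono h N).trans hN⟩

end LocalAlgebra

theorem statement12 (R : Type) [CommRing R] [IsLocalRing R] [IsNoetherianRing R]
    (M : Type) [AddCommGroup M] [Module R M] [Module.Finite R M]
    (r : ℕ) (hr : mDim R M = (r : ℕ∞)) (hr2 : 2 ≤ r)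
    (t : ℕ)
    (hbd : ∀ (Q : Ideal R) (e : ℕ → ℤ), IsParamIdeal R Q M r →
      HasHilbCoeffs R Q M r e → -(t : ℤ) ≤ e 1) :
    mDim R ↥(unmixedComp R M) ≤ ((r - 2 : ℕ) : ℕ∞) := by
  obtain ⟨d, rfl⟩ : ∃ d, r = d + 2 := ⟨r - 2, by omega⟩
  by_contra hcon
  obtain ⟨p, hp, hpd⟩ := exists_mem_associatedPrimes_coheight_eq hr hcon
  obtain ⟨v, hv⟩ := (isAssociatedPrime_iff.1 hp).2
  have hker : LinearMap.ker (LinearMap.toSpanSingleton R M v) = p.asIdeal := by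
    ext z
    rw [hv, LinearMap.mem_ker, LinearMap.toSpanSingleton_apply, Submodule.mem_colon_singleton,
      Submodule.mem_bot]
  have hpdim : ringKrullDim (R ⧸ p.asIdeal) = (d + 1 : ℕ) := by
    rw [ringKrullDim_quotient]
    exact (Order.coheight_eq_krullDim_Ici p).symm.trans (congrArg _ hpd)
  obtain ⟨x, hxm, b₀, hx⟩ := exists_fin_maximalIdeal_pow_le_span_sup hr
  obtain ⟨y, hym, b', hy⟩ := exists_fin_maximalIdeal_pow_le_span_sup hpdim
  obtain ⟨a, ha⟩ := exists_succ_pow_le_mul_length_quotient (d + 1) p hpd.ge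
  rw [Submodule.annihilator_top] at hx
  set k := 2 ^ (d + 1) * a * t + 1 with hk
  obtain ⟨b, hb⟩ := exists_maximalIdeal_pow_le_span_pow_sup hx (k := k)
  have hxk : Ideal.span (Set.range fun i => x i ^ k) ≤ maximalIdeal R ^ k := by
    rw [Ideal.span_le]
    rintro _ ⟨i, rfl⟩
    exact Ideal.pow_mem_pow (hxm i) k
  obtain ⟨s, hs, hs1⟩ :=
    exists_coeffs_of_le_maximalIdeal_pow hker hym hy ha hb (Nat.succ_pos _) hxk
  obtain ⟨N, hN⟩ := eventually_atTop.1 hs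
  have ht := hbd _ s ⟨hxk.trans (Ideal.pow_le_self (Nat.succ_ne_zero _)), ⟨_, rfl⟩,
    Module.length_ne_top_iff.1 (length_quotient_smul_top_ne_top hb)⟩
    ⟨N, fun n hn => by
      obtain ⟨l, hl, hls⟩ := hN n hn
      exact ⟨l, (Module.coe_length R _).symm.trans (congrArg _ hl), hls⟩⟩
  have h1 : (k : ℤ) ≤ k ^ (d + 1) * (d + 1).factorial := by
    have h2 : k ≤ k ^ (d + 1) * (d + 1).factorial :=
      (Nat.le_self_pow d.succ_ne_zero k).trans (Nat.le_mul_of_pos_right _ (Nat.factorial_pos _))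
    exact_mod_cast h2
  have h3 : ((2 ^ (d + 1) * a : ℕ) : ℤ) * -s 1 ≤ (2 ^ (d + 1) * a : ℕ) * (t : ℤ) :=
    mul_le_mul_of_nonneg_left (by linarith) (Nat.cast_nonneg _)
  have h4 := (h1.trans hs1).trans h3
  rw [hk] at h4
  norm_cast at h4
  omega
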